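/- Let n ∈ ℕ and let A, B ⊆ ℝ^{n+2} be disjoint subsets. Let β², γ² : Σ²A × Σ²B → ℝ^{n+6} ∖ {0} be the maps β²((s, t, v), (u, u′, w)) = (s, t, u, u′, v − w) and γ²((s, t, v), (u, u′, w)) = (s, t, u, u′, (1−|u|)(1−|u′|)·v − (1−|s|)(1−|t|)·w). Then the normalized maps x ↦ β²(x)/‖β²(x)‖ and x ↦ γ²(x)/‖γ²(x)‖ from Σ²A × Σ²B to the unit sphere S^{n+5} = {y ∈ ℝ^{n+6} : ‖y‖ = 1} are homotopic; that is, there exists a continuous map H : [0,1] × (Σ²A × Σ²B) → S^{n+5} with H(0, x) = β²(x)/‖β²(x)‖ and H(1, x) = γ²(x)/‖γ²(x)‖ for all x. -/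

import Mathlib

/-- `ℝ^{n+2}` as Euclidean space. -/
abbrev Euc (n : ℕ) := EuclideanSpace ℝ (Fin (n + 2))

/-- The double suspension `Σ²A ⊆ ℝ² × ℝ^{n+2}` of a subset `A ⊆ ℝ^{n+2}`:
`Σ²A = {(s, t, (1-|s|)(1-|t|)·a) : s, t ∈ [-1,1], a ∈ A}`. -/
def susp2 (n : ℕ) (A : Set (Euc n)) : Set (ℝ × ℝ × Euc n) :=
  {p | ∃ s ∈ Set.Icc (-1 : ℝ) 1, ∃ t ∈ Set.Icc (-1 : ℝ) 1, ∃ a ∈ A,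
    p = (s, t, ((1 - |s|) * (1 - |t|)) • a)}

/-- `β²((s,t,v),(u,u',w)) = (s, t, u, u', v - w)`. -/
noncomputable def beta2Map (n : ℕ) (x : (ℝ × ℝ × Euc n) × (ℝ × ℝ × Euc n)) :
    ℝ × ℝ × ℝ × ℝ × Euc n :=
  (x.1.1, x.1.2.1, x.2.1, x.2.2.1, x.1.2.2 - x.2.2.2)

/-- `γ²((s,t,v),(u,u',w)) = (s, t, u, u', (1-|u|)(1-|u'|)·v - (1-|s|)(1-|t|)·w)`. -/
noncomputable def gamma2Map (n : ℕ) (x : (ℝ × ℝ × Euc n) × (ℝ × ℝ × Euc n)) :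
    ℝ × ℝ × ℝ × ℝ × Euc n :=
  (x.1.1, x.1.2.1, x.2.1, x.2.2.1,
    ((1 - |x.2.1|) * (1 - |x.2.2.1|)) • x.1.2.2 -
      ((1 - |x.1.1|) * (1 - |x.1.2.1|)) • x.2.2.2)

/-- The Euclidean norm of a point of `ℝ × ℝ × ℝ × ℝ × ℝ^{n+2}`, identified
with `ℝ^{n+6}`. -/
noncomputable def eucNorm (n : ℕ) (y : ℝ × ℝ × ℝ × ℝ × Euc n) : ℝ :=
  Real.sqrt (y.1 ^ 2 + y.2.1 ^ 2 + y.2.2.1 ^ 2 + y.2.2.2.1 ^ 2 + ‖y.2.2.2.2‖ ^ 2)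

theorem continuous_eucNorm (n : ℕ) : Continuous (eucNorm n) := by
  unfold eucNorm
  fun_prop

theorem eucNorm_smul (n : ℕ) (c : ℝ) (y : ℝ × ℝ × ℝ × ℝ × Euc n) :
    eucNorm n (c • y) = |c| * eucNorm n y := by
  simp only [eucNorm, Prod.smul_fst, Prod.smul_snd, smul_eq_mul, norm_smul, Real.norm_eq_abs]
  rw [← Real.sqrt_sq_eq_abs, ← Real.sqrt_mul (sq_nonneg c)]
  congr 1
  rw [mul_pow √(c ^ 2), Real.sq_sqrt (sq_nonneg c)]
  ring

theorem eq_zero_of_eucNorm_eq_zero {n : ℕ} {y : ℝ × ℝ × ℝ × ℝ × Euc n} (h : eucNorm n y = 0) :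
    y = 0 := by
  obtain ⟨s, t, u, u', v⟩ := y
  rw [eucNorm, Real.sqrt_eq_zero (by positivity)] at h
  dsimp only at h
  have := sq_nonneg s
  have := sq_nonneg t
  have := sq_nonneg u
  have := sq_nonneg u'
  have := sq_nonneg ‖v‖
  have hs : s = 0 := (pow_eq_zero_iff two_ne_zero).mp (by linarith : s ^ 2 = 0)
  have ht : t = 0 := (pow_eq_zero_iff two_ne_zero).mp (by linarith : t ^ 2 = 0)
  have hu : u = 0 := (pow_eq_zero_iff two_ne_zero).mp (by linarith : u ^ 2 = 0)
  have hu' : u' = 0 := (pow_eq_zero_iff two_ne_zero).mp (by linarith : u' ^ 2 = 0)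
  have hv : ‖v‖ = 0 := (pow_eq_zero_iff two_ne_zero).mp (by linarith : ‖v‖ ^ 2 = 0)
  simp [hs, ht, hu, hu', norm_eq_zero.mp hv]

theorem eucNorm_inv_smul_self {n : ℕ} {y : ℝ × ℝ × ℝ × ℝ × Euc n} (h : eucNorm n y ≠ 0) :
    eucNorm n ((eucNorm n y)⁻¹ • y) = 1 := by
  have hnonneg : 0 ≤ eucNorm n y := Real.sqrt_nonneg _
  rw [eucNorm_smul, abs_of_nonneg (inv_nonneg.mpr hnonneg), inv_mul_cancel₀ h]

theorem continuous_beta2Map (n : ℕ) : Continuous (beta2Map n) := by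
  unfold beta2Map
  fun_prop

theorem continuous_gamma2Map (n : ℕ) : Continuous (gamma2Map n) := by
  unfold gamma2Map
  fun_prop

/-- The segment from `β²(x)` to `γ²(x)` avoids the origin: both maps share their first four
coordinates, and where these vanish both have last coordinate `a - b` with `a ∈ A`, `b ∈ B`. -/
theorem lineMap_beta2Map_gamma2Map_ne_zero {n : ℕ} {A B : Set (Euc n)} (hAB : Disjoint A B)
    {x : (ℝ × ℝ × Euc n) × (ℝ × ℝ × Euc n)} (hA : x.1 ∈ susp2 n A) (hB : x.2 ∈ susp2 n B)
    (r : ℝ) : AffineMap.lineMap (beta2Map n x) (gamma2Map n x) r ≠ 0 := by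
  obtain ⟨p, q⟩ := x
  obtain ⟨s, -, t, -, a, ha, rfl⟩ := hA
  obtain ⟨u, -, u', -, b, hb, rfl⟩ := hB
  intro h
  simp only [AffineMap.lineMap_apply_module', beta2Map, gamma2Map, Prod.ext_iff, Prod.fst_add,
    Prod.snd_add, Prod.smul_fst, Prod.smul_snd, Prod.fst_sub, Prod.snd_sub, sub_self, smul_zero,
    zero_add, Prod.fst_zero, Prod.snd_zero] at h
  obtain ⟨rfl, rfl, rfl, rfl, h⟩ := h
  simp only [abs_zero, sub_zero, mul_one, one_smul, sub_self, smul_zero, zero_add] at h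
  exact Set.disjoint_left.mp hAB ha (sub_eq_zero.mp h ▸ hb)

theorem stmt_9 (n : ℕ) (A B : Set (Euc n)) (hAB : Disjoint A B) :
    -- the normalized maps β²/‖β²‖ and γ²/‖γ²‖ into the unit sphere
    -- S^{n+5} = {y ∈ ℝ^{n+6} : ‖y‖ = 1} are homotopic
    ∃ H : Set.Icc (0 : ℝ) 1 ×
        {x : (ℝ × ℝ × Euc n) × (ℝ × ℝ × Euc n) // x.1 ∈ susp2 n A ∧ x.2 ∈ susp2 n B} →
        {y : ℝ × ℝ × ℝ × ℝ × Euc n // eucNorm n y = 1},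
      Continuous H ∧
      (∀ x, (H (⟨0, Set.left_mem_Icc.mpr zero_le_one⟩, x) : ℝ × ℝ × ℝ × ℝ × Euc n) =
        (eucNorm n (beta2Map n x))⁻¹ • beta2Map n x) ∧
      (∀ x, (H (⟨1, Set.right_mem_Icc.mpr zero_le_one⟩, x) : ℝ × ℝ × ℝ × ℝ × Euc n) =
        (eucNorm n (gamma2Map n x))⁻¹ • gamma2Map n x) := by
  have hne (p : Set.Icc (0 : ℝ) 1 × {x : (ℝ × ℝ × Euc n) × (ℝ × ℝ × Euc n) //
      x.1 ∈ susp2 n A ∧ x.2 ∈ susp2 n B}) :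
      eucNorm n (AffineMap.lineMap (beta2Map n p.2) (gamma2Map n p.2) (p.1 : ℝ)) ≠ 0 :=
    fun h => lineMap_beta2Map_gamma2Map_ne_zero hAB p.2.2.1 p.2.2.2 _
      (eq_zero_of_eucNorm_eq_zero h)
  refine ⟨fun p => ⟨_, eucNorm_inv_smul_self (hne p)⟩, ?_, fun x => by simp, fun x => by simp⟩
  have hβ := continuous_beta2Map n
  have hγ := continuous_gamma2Map n
  have hF : Continuous fun p : Set.Icc (0 : ℝ) 1 × {x : (ℝ × ℝ × Euc n) × (ℝ × ℝ × Euc n) //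
      x.1 ∈ susp2 n A ∧ x.2 ∈ susp2 n B} =>
      AffineMap.lineMap (beta2Map n p.2) (gamma2Map n p.2) (p.1 : ℝ) := by
    simp only [AffineMap.lineMap_apply_module']
    fun_prop
  exact (((continuous_eucNorm n).comp hF).inv₀ hne |>.smul hF).subtype_mk _
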